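/- arXiv:1606.04628 — 2 statements merged into one kernel-verified Lean document; each statement's English description precedes it below -/
import Mathlib

section
/- Let (Z₁,ρ₁) and (Z₂,ρ₂) be quasi-metric spaces and let f : Z₁ → Z₂ be a θ-quasimöbius bijection. If (Z₁,ρ₁) is σ-dense (σ > 1), then (Z₂,ρ₂) is σ'-dense with σ' = θ(σ) + 1. -/
open Filter Topology

universe u v

/-- `ρ` is a `K`-quasi-metric on `Z`: nonnegative, vanishing exactly on the diagonal,
symmetric, and satisfying `ρ(x,z) ≤ K·max(ρ(x,y), ρ(y,z))`. -/
def IsQuasiMetric {Z : Type*} (K : ℝ) (ρ : Z → Z → ℝ) : Prop :=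
  (∀ x y : Z, 0 ≤ ρ x y) ∧ (∀ x y : Z, ρ x y = 0 ↔ x = y) ∧
    (∀ x y : Z, ρ x y = ρ y x) ∧ (∀ x y z : Z, ρ x z ≤ K * max (ρ x y) (ρ y z))

/-- `(Z,ρ)` is `μ`-uniformly perfect. -/
def UniformlyPerfectWith {Z : Type*} (ρ : Z → Z → ℝ) (μ : ℝ) : Prop :=
  ∀ x : Z, ∀ r : ℝ, 0 < r → (∃ z : Z, r ≤ ρ x z) →
    ∃ y : Z, μ * r ≤ ρ x y ∧ ρ x y < r

/-- `(Z,ρ)` is `(l₁,l₂)`-homogeneously dense. -/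
def HomogeneouslyDense {Z : Type*} (ρ : Z → Z → ℝ) (l₁ l₂ : ℝ) : Prop :=
  ∀ a b : Z, a ≠ b → ∃ x : Z, l₁ * ρ a b ≤ ρ a x ∧ ρ a x ≤ l₂ * ρ a b

/-- The cross ratio `r(a,b,c,d) = ρ(a,c)ρ(b,d)/(ρ(a,b)ρ(c,d))`. -/
noncomputable def crossRatio {Z : Type*} (ρ : Z → Z → ℝ) (a b c d : Z) : ℝ :=
  ρ a c * ρ b d / (ρ a b * ρ c d)

/-- `x : ℤ → Z` is a `σ`-chain joining `a` and `b`. -/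
def IsSigmaChain {Z : Type*} (ρ : Z → Z → ℝ) (σ : ℝ) (a b : Z) (x : ℤ → Z) : Prop :=
  (∀ i : ℤ, a ≠ x i ∧ x i ≠ b) ∧
    Filter.Tendsto (fun i : ℤ => ρ (x i) a) Filter.atBot (nhds 0) ∧
    Filter.Tendsto (fun i : ℤ => ρ (x i) b) Filter.atTop (nhds 0) ∧
    ∀ i : ℤ, |Real.log (crossRatio ρ a (x i) (x (i + 1)) b)| ≤ Real.log σ

/-- `(Z,ρ)` is `σ`-dense: any pair of distinct points is joined by a `σ`-chain. -/
def SigmaDense {Z : Type*} (ρ : Z → Z → ℝ) (σ : ℝ) : Prop :=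
  ∀ a b : Z, a ≠ b → ∃ x : ℤ → Z, IsSigmaChain ρ σ a b x

/-- `η` is an increasing self-homeomorphism of `[0,∞)`. -/
def ControlFun (η : ℝ → ℝ) : Prop :=
  η 0 = 0 ∧ StrictMonoOn η (Set.Ici 0) ∧ ContinuousOn η (Set.Ici 0) ∧
    ∀ s : ℝ, 0 ≤ s → ∃ t : ℝ, 0 ≤ t ∧ η t = s

/-- `f` is `η`-quasisymmetric. -/
def QuasiSymmetric {Z₁ Z₂ : Type*} (ρ₁ : Z₁ → Z₁ → ℝ) (ρ₂ : Z₂ → Z₂ → ℝ)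
    (f : Z₁ → Z₂) (η : ℝ → ℝ) : Prop :=
  ∀ x a b : Z₁, x ≠ b → ∀ t : ℝ, 0 ≤ t → ρ₁ x a ≤ t * ρ₁ x b →
    ρ₂ (f x) (f a) ≤ η t * ρ₂ (f x) (f b)

/-- `f` is `θ`-quasimöbius. -/
def QuasiMobius {Z₁ Z₂ : Type*} (ρ₁ : Z₁ → Z₁ → ℝ) (ρ₂ : Z₂ → Z₂ → ℝ)
    (f : Z₁ → Z₂) (θ : ℝ → ℝ) : Prop :=
  ∀ a b c d : Z₁, a ≠ b → a ≠ c → a ≠ d → b ≠ c → b ≠ d → c ≠ d →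
    crossRatio ρ₂ (f a) (f b) (f c) (f d) ≤ θ (crossRatio ρ₁ a b c d)

/-- `(Z,ρ)` has no isolated points. -/
def NoIsolatedPoints {Z : Type*} (ρ : Z → Z → ℝ) : Prop :=
  ∀ x : Z, ∀ r : ℝ, 0 < r → ∃ y : Z, y ≠ x ∧ ρ x y < r
/-- Exchanging the two middle points inverts the cross ratio. -/
theorem crossRatio_swap_middle {Z : Type*} (ρ : Z → Z → ℝ) (a b c d : Z) :
    crossRatio ρ a c b d = (crossRatio ρ a b c d)⁻¹ := by
  simp only [crossRatio, inv_div]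

/-- The cross ratio of a quasi-metric is positive when each middle point differs from both ends. -/
theorem IsQuasiMetric.crossRatio_pos {Z : Type*} {K : ℝ} {ρ : Z → Z → ℝ}
    (h : IsQuasiMetric K ρ) {a b c d : Z} (hab : a ≠ b) (hac : a ≠ c) (hbd : b ≠ d)
    (hcd : c ≠ d) : 0 < crossRatio ρ a b c d := by
  have pos : ∀ {x y : Z}, x ≠ y → 0 < ρ x y := fun {x y} hxy =>
    lt_of_le_of_ne (h.1 x y) fun h0 => hxy ((h.2.1 x y).1 h0.symm)
  exact div_pos (mul_pos (pos hac) (pos hbd)) (mul_pos (pos hab) (pos hcd))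

/-- For positive `r` and `s`, `|log r| ≤ log s` says that both `r` and `r⁻¹` are at most `s`. -/
theorem abs_log_le_log_iff {r s : ℝ} (hr : 0 < r) (hs : 0 < s) :
    |Real.log r| ≤ Real.log s ↔ r ≤ s ∧ r⁻¹ ≤ s := by
  rw [abs_le', ← Real.log_inv, Real.log_le_log_iff hr hs,
    Real.log_le_log_iff (inv_pos.2 hr) hs]

/-- A sequentially continuous map preserves convergence along countably generated filters. -/
theorem tendsto_map_of_seq {Z₁ Z₂ ι : Type*} {ρ₁ : Z₁ → Z₁ → ℝ} {ρ₂ : Z₂ → Z₂ → ℝ} {f : Z₁ → Z₂}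
    (hf : ∀ (x : ℕ → Z₁) (a : Z₁), Tendsto (fun n => ρ₁ (x n) a) atTop (𝓝 0) →
      Tendsto (fun n => ρ₂ (f (x n)) (f a)) atTop (𝓝 0))
    {l : Filter ι} [l.IsCountablyGenerated] {x : ι → Z₁} {a : Z₁}
    (hx : Tendsto (fun i => ρ₁ (x i) a) l (𝓝 0)) :
    Tendsto (fun i => ρ₂ (f (x i)) (f a)) l (𝓝 0) :=
  tendsto_of_seq_tendsto fun u hu => hf (fun n => x (u n)) a (hx.comp hu)

/-- a quasimöbius homeomorphism maps a `σ`-dense space onto a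
`(θ(σ)+1)`-dense space. The homeomorphism property is expressed by sequential
bi-continuity with respect to the quasi-metrics (which induce metrizable topologies). -/
theorem stmt17 {Z₁ : Type u} {Z₂ : Type v} (K₁ K₂ σ : ℝ) (θ : ℝ → ℝ)
    (hK₁ : 1 ≤ K₁) (hK₂ : 1 ≤ K₂) (hσ : 1 < σ) (hθ : ControlFun θ)
    (ρ₁ : Z₁ → Z₁ → ℝ) (ρ₂ : Z₂ → Z₂ → ℝ)
    (hρ₁ : IsQuasiMetric K₁ ρ₁) (hρ₂ : IsQuasiMetric K₂ ρ₂)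
    (f : Z₁ → Z₂) (hbij : Function.Bijective f)
    (hhomeo : ∀ (x : ℕ → Z₁) (a : Z₁),
      Filter.Tendsto (fun n => ρ₁ (x n) a) Filter.atTop (nhds 0) ↔
        Filter.Tendsto (fun n => ρ₂ (f (x n)) (f a)) Filter.atTop (nhds 0))
    (hqm : QuasiMobius ρ₁ ρ₂ f θ) (hdense : SigmaDense ρ₁ σ) :
    SigmaDense ρ₂ (θ σ + 1) := by
  intro a' b' hab'
  obtain ⟨a, rfl⟩ := hbij.2 a'
  obtain ⟨b, rfl⟩ := hbij.2 b'
  have hab : a ≠ b := fun h => hab' (congrArg f h)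
  obtain ⟨x, hne, hbot, htop, hlog⟩ := hdense a b hab
  have hσ₀ : 0 < σ := one_pos.trans hσ
  have hθσ : 0 ≤ θ σ := by
    have := hθ.2.1.monotoneOn (Set.mem_Ici.2 le_rfl) (Set.mem_Ici.2 hσ₀.le) hσ₀.le
    rwa [hθ.1] at this
  have hinj : ∀ {p q : Z₁}, p ≠ q → f p ≠ f q := fun h => hbij.1.ne h
  have hseq := fun x a => (hhomeo x a).1
  refine ⟨fun i => f (x i), fun i => ⟨hinj (hne i).1, hinj (hne i).2⟩,
    tendsto_map_of_seq hseq hbot, tendsto_map_of_seq hseq htop, fun i => ?_⟩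
  obtain ⟨hai, hib⟩ := hne i
  obtain ⟨haj, hjb⟩ := hne (i + 1)
  have hr₁ := hρ₁.crossRatio_pos hai haj hib hjb
  have hr₂ := hρ₂.crossRatio_pos (hinj hai) (hinj haj) (hinj hib) (hinj hjb)
  obtain ⟨hle, hinv⟩ := (abs_log_le_log_iff hr₁ hσ₀).1 (hlog i)
  rw [abs_log_le_log_iff hr₂ (by linarith)]
  by_cases hij : x i = x (i + 1)
  · have h1 : crossRatio ρ₂ (f a) (f (x i)) (f (x (i + 1))) (f b) = 1 := by
      rw [← hij] at hr₂ ⊢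
      exact div_self fun h0 => by simp [crossRatio, h0] at hr₂
    rw [h1, inv_one]
    constructor <;> linarith
  have bound : ∀ {r : ℝ}, 0 < r → r ≤ σ → θ r ≤ θ σ + 1 := fun hr h =>
    (hθ.2.1.monotoneOn (Set.mem_Ici.2 hr.le) (Set.mem_Ici.2 hσ₀.le) h).trans (by linarith)
  refine ⟨(hqm _ _ _ _ hai haj hab hij hib hjb).trans (bound hr₁ hle), ?_⟩
  rw [← crossRatio_swap_middle]
  refine (hqm _ _ _ _ haj hai hab (Ne.symm hij) hjb hib).trans ?_
  rw [crossRatio_swap_middle]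
  exact bound (inv_pos.2 hr₁) hinv
end

section
/- Let (Z,ρ) be a K-quasi-metric space, let p ∈ Z, and let r > 0. Define the inversion ρ_p on Z∖{p} by ρ_p(x,y) = r²·ρ(x,y)/(ρ(x,p)·ρ(y,p)). Then ρ_p is a K²-quasi-metric on Z∖{p}, and if (Z∖{p}, ρ restricted to Z∖{p}) is uniformly perfect, then (Z∖{p}, ρ_p) is uniformly perfect. -/
open Filter Topology

universe u v

namespace IsQuasiMetric

variable {Z : Type*} {K : ℝ} {ρ : Z → Z → ℝ}

lemma nonneg (hρ : IsQuasiMetric K ρ) (x y : Z) : 0 ≤ ρ x y := hρ.1 x y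

lemma eq_zero_iff (hρ : IsQuasiMetric K ρ) (x y : Z) : ρ x y = 0 ↔ x = y := hρ.2.1 x y

lemma symm (hρ : IsQuasiMetric K ρ) (x y : Z) : ρ x y = ρ y x := hρ.2.2.1 x y

lemma pos (hρ : IsQuasiMetric K ρ) {x y : Z} (h : x ≠ y) : 0 < ρ x y :=
  (hρ.nonneg x y).lt_of_ne fun h0 => h ((hρ.eq_zero_iff x y).1 h0.symm)

lemma le_or_le (hρ : IsQuasiMetric K ρ) (x y z : Z) :
    ρ x z ≤ K * ρ x y ∨ ρ x z ≤ K * ρ y z := by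
  have h := hρ.2.2.2 x y z
  rcases max_choice (ρ x y) (ρ y z) with h' | h' <;> rw [h'] at h
  exacts [Or.inl h, Or.inr h]

lemma ptolemy_of_le (hK : 1 ≤ K) (hρ : IsQuasiMetric K ρ) {p x z : Z} (y : Z)
    (hxz : ρ x p ≤ ρ z p) :
    ρ x z * ρ y p ≤ K ^ 2 * (ρ x y * ρ z p) ∨ ρ x z * ρ y p ≤ K ^ 2 * (ρ y z * ρ x p) := by
  have hK0 : 0 ≤ K := by linarith
  have hxz' : ρ x z ≤ K * ρ z p := by
    rcases hρ.le_or_le x p z with h | h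
    · exact h.trans (mul_le_mul_of_nonneg_left hxz hK0)
    · rwa [hρ.symm p z] at h
  rcases hρ.le_or_le y x p with hy | hy
  · rw [hρ.symm y x] at hy
    left
    calc ρ x z * ρ y p ≤ (K * ρ z p) * (K * ρ x y) :=
          mul_le_mul hxz' hy (hρ.nonneg _ _) (mul_nonneg hK0 (hρ.nonneg _ _))
      _ = _ := by ring
  · rcases hρ.le_or_le x y z with h | h
    · left
      calc ρ x z * ρ y p ≤ (K * ρ x y) * (K * ρ z p) :=
            mul_le_mul h (hy.trans (mul_le_mul_of_nonneg_left hxz hK0)) (hρ.nonneg _ _)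
              (mul_nonneg hK0 (hρ.nonneg _ _))
        _ = _ := by ring
    · right
      calc ρ x z * ρ y p ≤ (K * ρ y z) * (K * ρ x p) :=
            mul_le_mul h hy (hρ.nonneg _ _) (mul_nonneg hK0 (hρ.nonneg _ _))
        _ = _ := by ring

/-- The quasi-metric form of Ptolemy's inequality. -/
lemma ptolemy (hK : 1 ≤ K) (hρ : IsQuasiMetric K ρ) (p x y z : Z) :
    ρ x z * ρ y p ≤ K ^ 2 * (ρ x y * ρ z p) ∨ ρ x z * ρ y p ≤ K ^ 2 * (ρ y z * ρ x p) := by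
  rcases le_total (ρ x p) (ρ z p) with h | h
  · exact hρ.ptolemy_of_le hK y h
  · have := hρ.ptolemy_of_le hK y h
    rw [hρ.symm z x, hρ.symm z y, hρ.symm y x] at this
    exact this.symm

lemma inversion (hK : 1 ≤ K) (hρ : IsQuasiMetric K ρ) (p : Z) {r : ℝ} (hr : 0 < r) :
    IsQuasiMetric (K ^ 2)
      (fun x y : {z : Z // z ≠ p} => r ^ 2 * ρ x y / (ρ x p * ρ y p)) := by
  refine ⟨fun x y => ?_, fun x y => ?_, fun x y => ?_, fun x y z => ?_⟩
  · have := hρ.nonneg x y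
    have := hρ.pos x.2
    have := hρ.pos y.2
    positivity
  · have hx := (hρ.pos x.2).ne'
    have hy := (hρ.pos y.2).ne'
    simp [hx, hy, hr.ne', hρ.eq_zero_iff, Subtype.ext_iff]
  · simp only [hρ.symm x y, mul_comm (ρ x p)]
  · have hx := hρ.pos x.2
    have hy := hρ.pos y.2
    have hz := hρ.pos z.2
    have key {m e f : ℝ} (hf : 0 < f) (h : ρ x z * ρ y p ≤ K ^ 2 * (m * e))
        (hef : e * f = ρ x p * ρ y p * ρ z p) :
        r ^ 2 * ρ x z / (ρ x p * ρ z p) ≤ K ^ 2 * (r ^ 2 * m / f) := by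
      rw [← mul_div_assoc, div_le_div_iff₀ (by positivity) hf]
      refine le_of_mul_le_mul_right ?_ hy
      calc r ^ 2 * ρ x z * f * ρ y p = r ^ 2 * f * (ρ x z * ρ y p) := by ring
        _ ≤ r ^ 2 * f * (K ^ 2 * (m * e)) := by gcongr
        _ = K ^ 2 * r ^ 2 * m * (e * f) := by ring
        _ = _ := by rw [hef]; ring
    rcases hρ.ptolemy hK p x y z with h | h
    · exact (key (mul_pos hx hy) h (by ring)).trans (by gcongr; exact le_max_left _ _)
    · exact (key (mul_pos hy hz) h (by ring)).trans (by gcongr; exact le_max_right _ _)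

lemma exists_annulus_of_small (hK : 1 ≤ K) (hρ : IsQuasiMetric K ρ) {p : Z} {μ : ℝ}
    (hμ : 0 < μ)
    (hu : UniformlyPerfectWith (fun x y : {z : Z // z ≠ p} => ρ x y) μ)
    {x z : {z : Z // z ≠ p}} {t C : ℝ} (ht : 0 < t) (hC : 1 ≤ C) (htC : t * ρ x p ≤ C)
    (hz : t * ρ x p * ρ z p ≤ ρ x z) :
    ∃ y : {z : Z // z ≠ p},
      μ / (K ^ 2 * C) * t * (ρ x p * ρ y p) ≤ ρ x y ∧ ρ x y < t * (ρ x p * ρ y p) := by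
  have hK0 : 0 < K := by linarith
  have hx := hρ.pos x.2
  set a := ρ x p with ha
  -- a radius comparable to `t * a ^ 2`, within which `ρ y p` is comparable to `a`
  obtain ⟨R, hR0, hR1, hR2, hR3⟩ :
      ∃ R : ℝ, 0 < R ∧ K * R ≤ a ∧ K * R ≤ t * a ^ 2 ∧ t * a ^ 2 ≤ K * R * C := by
    rcases le_total (t * a) 1 with h | h
    · refine ⟨t * a ^ 2 / K, by positivity, ?_, ?_, ?_⟩ <;> rw [mul_div_cancel₀ _ hK0.ne']
      · nlinarith
      · exact le_mul_of_one_le_right (by positivity) hC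
    · refine ⟨a / K, by positivity, ?_, ?_, ?_⟩ <;> rw [mul_div_cancel₀ _ hK0.ne']
      · nlinarith
      · nlinarith
  have near (y : {z : Z // z ≠ p}) (hy : ρ x y < R) : a ≤ K * ρ y p := by
    rcases hρ.le_or_le x y p with h | h
    · nlinarith
    · exact h
  obtain ⟨y, hy1, hy2⟩ := hu x R hR0 ⟨z, by
    by_contra! hlt
    have h1 := near z hlt
    have h2 : t * a * a ≤ t * a * (K * ρ z p) := by gcongr
    nlinarith⟩
  simp only at hy1 hy2
  have hya := near y hy2
  have hyp : ρ y p ≤ K * a := by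
    rcases hρ.le_or_le y x p with h | h
    · rw [hρ.symm y x] at h
      nlinarith
    · exact h
  refine ⟨y, ?_, ?_⟩
  · refine le_trans ?_ hy1
    calc μ / (K ^ 2 * C) * t * (a * ρ y p) ≤ μ / (K ^ 2 * C) * t * (a * (K * a)) := by gcongr
      _ = μ / (K * C) * (t * a ^ 2) := by field_simp
      _ ≤ μ / (K * C) * (K * R * C) := by gcongr
      _ = μ * R := by field_simp
  · have h2 : t * a * a ≤ t * a * (K * ρ y p) := by gcongr
    nlinarith

lemma exists_annulus_of_large (hK : 1 ≤ K) (hρ : IsQuasiMetric K ρ) {p : Z} {μ : ℝ}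
    (hμ : 0 < μ) (hμ1 : μ < 1)
    (hu : UniformlyPerfectWith (fun x y : {z : Z // z ≠ p} => ρ x y) μ)
    {x z : {z : Z // z ≠ p}} {t : ℝ} (ht : 0 < t) (htC : 2 * K ^ 4 / μ < t * ρ x p)
    (hz : t * ρ x p * ρ z p ≤ ρ x z) :
    ∃ y : {z : Z // z ≠ p},
      μ / (2 * K ^ 4) * t * (ρ x p * ρ y p) ≤ ρ x y ∧ ρ x y < t * (ρ x p * ρ y p) := by
  have hK0 : 0 < K := by linarith
  have hx := hρ.pos x.2
  have hzp := hρ.pos z.2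
  set a := ρ x p with ha
  -- the points at distance about `R` from `z` are the required ones
  set R := 2 * K ^ 2 / (μ * t) with hR
  have hR0 : 0 < R := by positivity
  have hμR : μ * R * t = 2 * K ^ 2 := by rw [hR]; field_simp
  have hRa : K ^ 2 * R < a := by
    have : K ^ 2 * R = 2 * K ^ 4 / μ / t := by rw [hR]; field_simp
    rw [this, div_lt_iff₀ ht]
    linarith
  have hKR : K * R ≤ K ^ 2 * R := by gcongr; nlinarith
  have hRK : K < R * t := by nlinarith [mul_pos hR0 ht]
  have hzt : t * ρ z p ≤ K := by
    rcases hρ.le_or_le x p z with h | h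
    · refine le_of_mul_le_mul_right ?_ hx
      linarith
    · rw [hρ.symm p z] at h
      have h3 : t * a ≤ K := le_of_mul_le_mul_right (hz.trans h) hzp
      nlinarith
  have hzR : ρ z p < R := lt_of_mul_lt_mul_left (by linarith) ht.le
  have hxzR : R ≤ ρ z x := by
    rw [hρ.symm z x]
    rcases hρ.le_or_le x z p with h | h
    · refine le_of_mul_le_mul_left ?_ hK0
      linarith
    · nlinarith
  obtain ⟨y, hy1, hy2⟩ := hu z R hR0 ⟨x, hxzR⟩
  simp only at hy1 hy2
  have hyp1 : μ * R ≤ K * ρ y p := by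
    rcases hρ.le_or_le z p y with h | h
    · have : μ * R * t ≤ K * ρ z p * t := mul_le_mul_of_nonneg_right (hy1.trans h) ht.le
      nlinarith
    · rw [hρ.symm p y] at h
      exact hy1.trans h
  have hyp2 : ρ y p ≤ K * R := by
    rcases hρ.le_or_le y z p with h | h
    · rw [hρ.symm y z] at h
      nlinarith
    · nlinarith
  have hxy1 : a ≤ K * ρ x y := by
    rcases hρ.le_or_le x y p with h | h
    · exact h
    · nlinarith
  have hxy2 : ρ x y ≤ K * a := by
    rcases hρ.le_or_le x p y with h | h
    · exact h
    · rw [hρ.symm p y] at h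
      nlinarith
  refine ⟨y, ?_, ?_⟩
  · calc μ / (2 * K ^ 4) * t * (a * ρ y p) ≤ μ / (2 * K ^ 4) * t * (a * (K * R)) := by gcongr
      _ = a * (μ * R * t) / (2 * K ^ 3) := by field_simp
      _ = a / K := by rw [hμR]; field_simp
      _ ≤ ρ x y := by rwa [div_le_iff₀' hK0]
  · have h1 : 2 * K ^ 2 ≤ K * ρ y p * t := hμR ▸ mul_le_mul_of_nonneg_right hyp1 ht.le
    have h2 : 2 * K ≤ ρ y p * t := le_of_mul_le_mul_left (by linarith) hK0
    nlinarith

end IsQuasiMetric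

/-- the inversion `ρ_p(x,y) = r²ρ(x,y)/(ρ(x,p)ρ(y,p))` is a
`K²`-quasi-metric on `Z ∖ {p}`, and it is uniformly perfect whenever `(Z ∖ {p}, ρ)` is. -/
theorem stmt19 {Z : Type u} (K : ℝ) (hK : 1 ≤ K) (ρ : Z → Z → ℝ)
    (hρ : IsQuasiMetric K ρ) (p : Z) (r : ℝ) (hr : 0 < r) :
    IsQuasiMetric (K ^ 2)
      (fun x y : {z : Z // z ≠ p} => r ^ 2 * ρ x y / (ρ x p * ρ y p)) ∧
    ((∃ μ : ℝ, 0 < μ ∧ μ < 1 ∧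
        UniformlyPerfectWith (fun x y : {z : Z // z ≠ p} => ρ x y) μ) →
      ∃ μ' : ℝ, 0 < μ' ∧ μ' < 1 ∧
        UniformlyPerfectWith
          (fun x y : {z : Z // z ≠ p} => r ^ 2 * ρ x y / (ρ x p * ρ y p)) μ') := by
  refine ⟨hρ.inversion hK p hr, ?_⟩
  rintro ⟨μ, hμ, hμ1, hu⟩
  have hK4 : 1 ≤ K ^ 4 := one_le_pow₀ hK
  have hC : 1 ≤ 2 * K ^ 4 / μ := by
    rw [le_div_iff₀ hμ]
    linarith
  have hden : 1 ≤ K ^ 2 * (2 * K ^ 4 / μ) := one_le_mul_of_one_le_of_one_le (one_le_pow₀ hK) hC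
  refine ⟨μ / (K ^ 2 * (2 * K ^ 4 / μ)), by positivity, ?_, ?_⟩
  · rw [div_lt_one (by linarith)]
    linarith
  intro x s hs ⟨z, hz⟩
  have hx := hρ.pos x.2
  have hr2 : 0 < r ^ 2 := by positivity
  obtain ⟨t, ht, rfl⟩ : ∃ t : ℝ, 0 < t ∧ s = r ^ 2 * t := ⟨s / r ^ 2, by positivity, by field_simp⟩
  rw [le_div_iff₀ (mul_pos hx (hρ.pos z.2)), mul_assoc, mul_le_mul_iff_right₀ hr2,
    ← mul_assoc] at hz
  obtain ⟨y, hy1, hy2⟩ : ∃ y : {z : Z // z ≠ p},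
      μ / (K ^ 2 * (2 * K ^ 4 / μ)) * t * (ρ x p * ρ y p) ≤ ρ x y ∧
        ρ x y < t * (ρ x p * ρ y p) := by
    rcases le_or_gt (t * ρ x p) (2 * K ^ 4 / μ) with h | h
    · exact hρ.exists_annulus_of_small hK hμ hu ht hC h hz
    · obtain ⟨y, hy1, hy2⟩ := hρ.exists_annulus_of_large hK hμ hμ1 hu ht h hz
      refine ⟨y, le_trans ?_ hy1, hy2⟩
      have hy := hρ.pos y.2
      have : 2 * K ^ 4 ≤ K ^ 2 * (2 * K ^ 4 / μ) := by
        rw [← mul_div_assoc, le_div_iff₀ hμ]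
        have : 1 ≤ K ^ 2 := one_le_pow₀ hK
        nlinarith
      have := div_le_div_of_nonneg_left hμ.le (by positivity) this
      exact mul_le_mul_of_nonneg_right (mul_le_mul_of_nonneg_right this ht.le) (by positivity)
  have hxy := mul_pos hx (hρ.pos y.2)
  refine ⟨y, ?_, ?_⟩
  · rw [le_div_iff₀ hxy]
    calc _ = r ^ 2 * (μ / (K ^ 2 * (2 * K ^ 4 / μ)) * t * (ρ x p * ρ y p)) := by ring
      _ ≤ _ := by gcongr
  · rw [div_lt_iff₀ hxy, mul_assoc]
    gcongr
end
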